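/- Let N ≥ 1 and let u : ℝ × EuclideanSpace ℝ (Fin N) → ℝ be smooth with u > 0 everywhere and ∂_t u = Δu on all of ℝ × ℝ^N (an entire positive solution of the heat equation). Then for every real γ > 1 and at every point (t,x): ‖∇u/u‖² − γ·∂_t(log u) ≤ 0. -/

import Mathlib

open scoped RealInnerProductSpace

/-- Second partial derivative `∂ᵢ∂ⱼ f` with respect to the standard coordinates. -/
noncomputable def pd2 {N : ℕ} (f : EuclideanSpace ℝ (Fin N) → ℝ) (i j : Fin N)
    (x : EuclideanSpace ℝ (Fin N)) : ℝ :=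
  fderiv ℝ (fun y => fderiv ℝ f y (EuclideanSpace.single i 1)) x (EuclideanSpace.single j 1)

/-- Laplacian: sum of the second partial derivatives `∂ᵢ∂ᵢ f`. -/
noncomputable def lap {N : ℕ} (f : EuclideanSpace ℝ (Fin N) → ℝ)
    (x : EuclideanSpace ℝ (Fin N)) : ℝ :=
  ∑ i, pd2 f i i x

/-- Spatial gradient of a function of `(t, x)`. -/
noncomputable def sgrad {N : ℕ} (u : ℝ × EuclideanSpace ℝ (Fin N) → ℝ) (t : ℝ)
    (x : EuclideanSpace ℝ (Fin N)) : EuclideanSpace ℝ (Fin N) :=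
  gradient (fun y => u (t, y)) x

/-- Spatial second partial derivative of a function of `(t, x)`. -/
noncomputable def spd2 {N : ℕ} (u : ℝ × EuclideanSpace ℝ (Fin N) → ℝ) (i j : Fin N) (t : ℝ)
    (x : EuclideanSpace ℝ (Fin N)) : ℝ :=
  pd2 (fun y => u (t, y)) i j x

/-- Spatial Laplacian of a function of `(t, x)`. -/
noncomputable def slap {N : ℕ} (u : ℝ × EuclideanSpace ℝ (Fin N) → ℝ) (t : ℝ)
    (x : EuclideanSpace ℝ (Fin N)) : ℝ :=
  lap (fun y => u (t, y)) x

/-- Time derivative `∂ₜ u` of a function of `(t, x)`. -/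
noncomputable def partialT {N : ℕ} (u : ℝ × EuclideanSpace ℝ (Fin N) → ℝ) (t : ℝ)
    (x : EuclideanSpace ℝ (Fin N)) : ℝ :=
  deriv (fun s => u (s, x)) t

section LY
variable {V : Type*} [NormedAddCommGroup V] [NormedSpace ℝ V]

noncomputable def DD (v : V) (F : V → ℝ) (z : V) : ℝ := fderiv ℝ F z v

abbrev Sm (F : V → ℝ) : Prop := ContDiff ℝ (⊤ : ℕ∞) F

lemma Sm.da {F : V → ℝ} (h : Sm F) (z : V) : DifferentiableAt ℝ F z :=
  h.contDiffAt.differentiableAt (by simp)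

lemma DD_sm {F : V → ℝ} (h : Sm F) (v : V) : Sm (DD v F) := by
  unfold DD Sm
  exact (h.fderiv_right (m := (⊤ : ℕ∞)) (by simp)).clm_apply contDiff_const

lemma DD_add {F G : V → ℝ} (hF : Sm F) (hG : Sm G) (v : V) (z : V) :
    DD v (fun z => F z + G z) z = DD v F z + DD v G z := by
  unfold DD
  rw [fderiv_fun_add (hF.da z) (hG.da z)]; rfl

lemma DD_sub {F G : V → ℝ} (hF : Sm F) (hG : Sm G) (v : V) (z : V) :
    DD v (fun z => F z - G z) z = DD v F z - DD v G z := by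
  unfold DD
  rw [fderiv_fun_sub (hF.da z) (hG.da z)]; rfl

lemma DD_mul {F G : V → ℝ} (hF : Sm F) (hG : Sm G) (v : V) (z : V) :
    DD v (fun z => F z * G z) z = DD v F z * G z + F z * DD v G z := by
  unfold DD
  rw [fderiv_fun_mul (hF.da z) (hG.da z)]; simp; ring

lemma DD_const (c : ℝ) (v : V) (z : V) : DD v (fun _ => c) z = 0 := by
  unfold DD; simp

lemma DD_cmul {G : V → ℝ} (c : ℝ) (hG : Sm G) (v : V) (z : V) :
    DD v (fun z => c * G z) z = c * DD v G z := by
  rw [DD_mul contDiff_const hG, DD_const]; ring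

lemma DD_sum {n : ℕ} {F : Fin n → V → ℝ} (hF : ∀ i, Sm (F i)) (v : V) (z : V) :
    DD v (fun z => ∑ i, F i z) z = ∑ i, DD v (F i) z := by
  unfold DD
  rw [fderiv_fun_sum (fun i _ => (hF i).da z)]; simp

lemma DD_comm {F : V → ℝ} (hF : Sm F) (v w : V) : DD v (DD w F) = DD w (DD v F) := by
  funext z
  have hs : IsSymmSndFDerivAt ℝ F z := hF.contDiffAt.isSymmSndFDerivAt (by
    simp only [minSmoothness_of_isRCLikeNormedField]; exact WithTop.coe_le_coe.2 (le_top (a := (2 : ℕ∞))))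
  have hd : DifferentiableAt ℝ (fderiv ℝ F) z :=
    ((hF.fderiv_right (m := (⊤ : ℕ∞)) (by simp)).contDiffAt).differentiableAt (by simp)
  have key : ∀ a b : V, DD a (DD b F) z = fderiv ℝ (fderiv ℝ F) z a b := by
    intro a b
    change fderiv ℝ (fun y => fderiv ℝ F y b) z a = _
    rw [fderiv_clm_apply hd (differentiableAt_const b)]
    simp
  rw [key, key]; exact hs v w

lemma line_deriv {F : V → ℝ} (hF : Sm F) (z v : V) (s : ℝ) :
    HasDerivAt (fun s : ℝ => F (z + s • v)) (DD v F (z + s • v)) s := by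
  have h1 : HasDerivAt (fun s : ℝ => z + s • v) v s := by
    simpa using ((hasDerivAt_id s).smul_const v).const_add z
  exact (hF.da _).hasFDerivAt.comp_hasDerivAt s h1

lemma DD_max {W : V → ℝ} {z : V} (h : IsLocalMax W z) (v : V) : DD v W z = 0 := by
  unfold DD; rw [h.fderiv_eq_zero]; rfl

lemma DD2_max {W : V → ℝ} (hW : Sm W) {z : V} (h : IsLocalMax W z) (v : V) :
    DD v (DD v W) z ≤ 0 := by
  by_contra hc
  push Not at hc
  set g : ℝ → ℝ := fun s => W (z + s • v) with hg
  have hd : deriv g = fun s => DD v W (z + s • v) := by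
    funext s; exact (line_deriv hW z v s).deriv
  have hdd : deriv (deriv g) 0 = DD v (DD v W) z := by
    rw [hd, (line_deriv (DD_sm hW v) z v 0).deriv]; simp
  have hmin : IsLocalMin g 0 := by
    apply isLocalMin_of_deriv_deriv_pos
    · rw [hdd]; exact hc
    · rw [hd]; simpa using DD_max h v
    · exact (line_deriv hW z v 0).continuousAt
  have hmax : IsLocalMax g 0 := by
    have hcont : Filter.Tendsto (fun s : ℝ => z + s • v) (nhds 0) (nhds z) := by
      have : Continuous (fun s : ℝ => z + s • v) := by fun_prop
      simpa using this.tendsto 0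
    have := hcont.eventually h
    simpa [IsLocalMax, IsMaxFilter, hg] using this
  have heq : g =ᶠ[nhds 0] fun _ => g 0 := by
    filter_upwards [hmin, hmax] with s h1 h2
    exact le_antisymm h2 h1
  have : deriv (deriv g) 0 = 0 := by
    rw [heq.deriv.deriv_eq]; simp
  linarith
end LY

section LY2
variable {V : Type*} [NormedAddCommGroup V] [NormedSpace ℝ V]

noncomputable def GG {n : ℕ} (e0 : V) (e : Fin n → V) (γ : ℝ) (f : V → ℝ) (z : V) : ℝ :=
  (∑ i, DD (e i) f z * DD (e i) f z) - γ * DD e0 f z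

lemma sumsq_sm {n : ℕ} (e : Fin n → V) {f : V → ℝ} (hf : Sm f) :
    Sm (fun z => ∑ i, DD (e i) f z * DD (e i) f z) :=
  ContDiff.sum (fun i _ => (DD_sm hf (e i)).mul (DD_sm hf (e i)))

lemma GG_sm {n : ℕ} (e0 : V) (e : Fin n → V) (γ : ℝ) {f : V → ℝ} (hf : Sm f) :
    Sm (GG e0 e γ f) :=
  (sumsq_sm e hf).sub (contDiff_const.mul (DD_sm hf e0))

lemma DD_sumsq {n : ℕ} (e : Fin n → V) {f : V → ℝ} (hf : Sm f) (v z : V) :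
    DD v (fun z => ∑ i, DD (e i) f z * DD (e i) f z) z
      = ∑ i, 2 * (DD (e i) f z * DD v (DD (e i) f) z) := by
  rw [DD_sum (fun i => (DD_sm hf (e i)).mul (DD_sm hf (e i)))]
  refine Finset.sum_congr rfl fun i _ => ?_
  rw [DD_mul (DD_sm hf (e i)) (DD_sm hf (e i))]; ring

lemma DD_GG {n : ℕ} (e0 : V) (e : Fin n → V) (γ : ℝ) {f : V → ℝ} (hf : Sm f) (v z : V) :
    DD v (GG e0 e γ f) z
      = (∑ i, 2 * (DD (e i) f z * DD v (DD (e i) f) z)) - γ * DD v (DD e0 f) z := by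
  unfold GG
  rw [DD_sub (sumsq_sm e hf) (contDiff_const.mul (DD_sm hf e0)), DD_sumsq e hf,
    DD_cmul _ (DD_sm hf e0)]

lemma DD2_GG {n : ℕ} (e0 : V) (e : Fin n → V) (γ : ℝ) {f : V → ℝ} (hf : Sm f) (v z : V) :
    DD v (DD v (GG e0 e γ f)) z
      = (∑ i, 2 * (DD v (DD (e i) f) z ^ 2 + DD (e i) f z * DD v (DD v (DD (e i) f)) z))
        - γ * DD v (DD v (DD e0 f)) z := by
  have h : DD v (GG e0 e γ f) = fun z =>
      (∑ i, 2 * (DD (e i) f z * DD v (DD (e i) f) z)) - γ * DD v (DD e0 f) z := by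
    funext z; exact DD_GG e0 e γ hf v z
  have h1 : ∀ i, Sm (fun z => DD (e i) f z * DD v (DD (e i) f) z) := fun i =>
    (DD_sm hf (e i)).mul (DD_sm (DD_sm hf (e i)) v)
  have h2 : ∀ i, Sm (fun z => 2 * (DD (e i) f z * DD v (DD (e i) f) z)) := fun i =>
    contDiff_const.mul (h1 i)
  rw [h, DD_sub (ContDiff.sum fun i _ => h2 i)
    (contDiff_const.mul (DD_sm (DD_sm hf e0) v)), DD_sum h2,
    DD_cmul _ (DD_sm (DD_sm hf e0) v)]
  congr 1
  refine Finset.sum_congr rfl fun i _ => ?_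
  rw [DD_cmul _ (h1 i), DD_mul (DD_sm hf (e i)) (DD_sm (DD_sm hf (e i)) v)]; ring

/-- Differentiated equation. -/
lemma heat_diff {n : ℕ} (e0 : V) (e : Fin n → V) {f : V → ℝ} (hf : Sm f)
    (heat : ∀ z, DD e0 f z = (∑ j, DD (e j) (DD (e j) f) z) + ∑ j, DD (e j) f z * DD (e j) f z)
    (v z : V) :
    DD v (DD e0 f) z = (∑ j, DD (e j) (DD (e j) (DD v f)) z)
      + ∑ j, 2 * (DD (e j) f z * DD v (DD (e j) f) z) := by
  have h : DD e0 f = fun z => (∑ j, DD (e j) (DD (e j) f) z) + ∑ j, DD (e j) f z * DD (e j) f z :=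
    funext heat
  have h1 : ∀ j, Sm (DD (e j) (DD (e j) f)) := fun j => DD_sm (DD_sm hf _) _
  rw [h, DD_add (ContDiff.sum fun j _ => h1 j) (sumsq_sm e hf), DD_sumsq e hf, DD_sum h1]
  congr 1
  refine Finset.sum_congr rfl fun j _ => ?_
  rw [DD_comm (DD_sm hf (e j)) v, DD_comm hf v]

lemma evol {n : ℕ} (e0 : V) (e : Fin n → V) (γ : ℝ) {f : V → ℝ} (hf : Sm f)
    (heat : ∀ z, DD e0 f z = (∑ j, DD (e j) (DD (e j) f) z) + ∑ j, DD (e j) f z * DD (e j) f z)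
    (z : V) :
    ∑ j, DD (e j) (DD (e j) (GG e0 e γ f)) z
      = DD e0 (GG e0 e γ f) z - 2 * (∑ j, DD (e j) f z * DD (e j) (GG e0 e γ f) z)
        + 2 * ∑ j, ∑ i, DD (e j) (DD (e i) f) z ^ 2 := by
  simp only [DD2_GG e0 e γ hf, DD_GG e0 e γ hf]
  have hi : ∀ i, ∑ j, DD (e j) (DD (e j) (DD (e i) f)) z
      = DD (e i) (DD e0 f) z - ∑ j, 2 * (DD (e j) f z * DD (e i) (DD (e j) f) z) := by
    intro i; rw [heat_diff e0 e hf heat (e i) z]; ring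
  have h0 : ∑ j, DD (e j) (DD (e j) (DD e0 f)) z
      = DD e0 (DD e0 f) z - ∑ j, 2 * (DD (e j) f z * DD e0 (DD (e j) f) z) := by
    rw [heat_diff e0 e hf heat e0 z]; ring
  have hA : ∑ j, ∑ i, DD (e i) f z * DD (e j) (DD (e j) (DD (e i) f)) z
      = (∑ i, DD (e i) f z * DD e0 (DD (e i) f) z)
        - ∑ j, DD (e j) f z * ∑ i, 2 * (DD (e i) f z * DD (e j) (DD (e i) f) z) := by
    rw [Finset.sum_comm, ← Finset.sum_sub_distrib]
    refine Finset.sum_congr rfl fun i _ => ?_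
    rw [← Finset.mul_sum, hi i, DD_comm hf e0 (e i)]; ring
  have hB : ∑ j, DD (e j) f z * DD (e j) (DD e0 f) z
      = ∑ j, DD (e j) f z * DD e0 (DD (e j) f) z :=
    Finset.sum_congr rfl fun i _ => by rw [DD_comm hf e0 (e i)]
  simp only [Finset.sum_sub_distrib, ← Finset.mul_sum, Finset.sum_add_distrib, mul_sub, mul_add]
    at hA h0 ⊢
  have hC : ∑ j, DD (e j) f z * (γ * DD (e j) (DD e0 f) z)
      = γ * ∑ j, DD (e j) f z * DD e0 (DD (e j) f) z := by
    rw [← hB, Finset.mul_sum]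
    exact Finset.sum_congr rfl fun i _ => by ring
  rw [hA, h0, hC]
  ring

/-- Hessian lower bound. -/
lemma hess_lb {n : ℕ} (H : Fin n → Fin n → ℝ) :
    (∑ j, H j j) ^ 2 ≤ n * ∑ j, ∑ i, H j i ^ 2 := by
  have h1 : (∑ j, H j j) ^ 2 ≤ n * ∑ j, H j j ^ 2 := by
    simpa using sq_sum_le_card_mul_sum_sq (s := Finset.univ) (f := fun j => H j j)
  refine h1.trans ?_
  gcongr with j
  exact Finset.single_le_sum (f := fun i => H j i ^ 2) (fun i _ => sq_nonneg _) (Finset.mem_univ j)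

lemma young_aux (a X P Q : ℝ) (hP : 0 ≤ P) (hQ : 0 ≤ Q) (h : X ^ 2 ≤ P * Q) :
    -(2 * (a * X)) ≤ a ^ 2 * P + Q := by
  have h6 : (2 * (a * X)) ^ 2 ≤ (a ^ 2 * P + Q) ^ 2 := by
    have h1 := mul_le_mul_of_nonneg_left h (sq_nonneg a)
    have h2 := sq_nonneg (a ^ 2 * P - Q)
    linarith
  have h7 := abs_le_of_sq_le_sq' h6 (by positivity)
  linarith [h7.1]

set_option maxHeartbeats 1000000 in
/-- Key estimate at an interior maximum. -/
lemma key_max {n : ℕ} (hn : 1 ≤ n) (e0 : V) (e : Fin n → V) (γ : ℝ) (hγ : 1 < γ)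
    {f : V → ℝ} (hf : Sm f)
    (heat : ∀ z, DD e0 f z = (∑ j, DD (e j) (DD (e j) f) z) + ∑ j, DD (e j) f z * DD (e j) f z)
    {φ : V → ℝ} (hφ : Sm φ) (z : V) (hφz : 0 < φ z) (hG : 0 < GG e0 e γ f z)
    (hmax : IsLocalMax (fun z => φ z * φ z * GG e0 e γ f z) z) :
    2 / (n * γ ^ 2) * (φ z * φ z * GG e0 e γ f z) ≤
      2 * φ z * DD e0 φ z - 2 * φ z * (∑ j, DD (e j) (DD (e j) φ) z)
        + (6 + n * γ ^ 2 / (γ - 1)) * ∑ j, DD (e j) φ z ^ 2 := by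
  set G := GG e0 e γ f with hGdef
  have hGs : Sm G := GG_sm e0 e γ hf
  have hφ2 : Sm (fun z => φ z * φ z) := hφ.mul hφ
  have hWs : Sm (fun z => φ z * φ z * G z) := hφ2.mul hGs
  have hD : ∀ v y, DD v (fun z => φ z * φ z * G z) y
      = 2 * (φ y * DD v φ y * G y) + φ y * φ y * DD v G y := by
    intro v y
    rw [DD_mul hφ2 hGs, DD_mul hφ hφ]; ring
  have h0 : ∀ v, φ z * DD v G z = - 2 * DD v φ z * G z := by
    intro v
    have := DD_max hmax v
    rw [hD] at this
    apply mul_left_cancel₀ hφz.ne'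
    linarith
  have hDD : ∀ v, DD v (DD v (fun z => φ z * φ z * G z)) z
      = 2 * φ z * DD v (DD v φ) z * G z + φ z ^ 2 * DD v (DD v G) z - 6 * DD v φ z ^ 2 * G z := by
    intro v
    rw [show DD v (fun z => φ z * φ z * G z) = fun y =>
      2 * (φ y * DD v φ y * G y) + φ y * φ y * DD v G y from funext (hD v)]
    have s1 : Sm (fun y => φ y * DD v φ y) := hφ.mul (DD_sm hφ v)
    have s2 : Sm (fun y => φ y * DD v φ y * G y) := s1.mul hGs
    rw [DD_add (contDiff_const.mul s2) (hφ2.mul (DD_sm hGs v)), DD_cmul _ s2, DD_mul s1 hGs,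
      DD_mul hφ (DD_sm hφ v), DD_mul hφ2 (DD_sm hGs v), DD_mul hφ hφ]
    linear_combination 4 * DD v φ z * h0 v
  have hsum : ∑ j, DD (e j) (DD (e j) (fun z => φ z * φ z * G z)) z ≤ 0 :=
    Finset.sum_nonpos fun j _ => DD2_max hWs hmax (e j)
  simp only [hDD, Finset.sum_sub_distrib, Finset.sum_add_distrib, ← Finset.mul_sum,
    ← Finset.sum_mul] at hsum
  rw [evol e0 e γ hf heat z, ← hGdef] at hsum
  set S := ∑ j, ∑ i, DD (e j) (DD (e i) f) z ^ 2 with hS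
  set L := ∑ j, DD (e j) (DD (e j) φ) z with hL
  set Q := ∑ j, DD (e j) φ z ^ 2 with hQ
  set P := ∑ j, DD (e j) f z * DD (e j) f z with hP
  set X := ∑ j, DD (e j) f z * DD (e j) φ z with hX
  have hXG : φ z * ∑ j, DD (e j) f z * DD (e j) G z = - 2 * X * G z := by
    rw [hX, Finset.mul_sum, Finset.mul_sum, Finset.sum_mul]
    refine Finset.sum_congr rfl fun j _ => ?_
    linear_combination DD (e j) f z * h0 (e j)
  have hCS : X ^ 2 ≤ P * Q := by
    have := Finset.sum_mul_sq_le_sq_mul_sq Finset.univ (fun j => DD (e j) f z)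
      (fun j => DD (e j) φ z)
    simpa [hX, hP, hQ, pow_two] using this
  have hPn : 0 ≤ P := Finset.sum_nonneg fun j _ => mul_self_nonneg _
  have hQn : 0 ≤ Q := Finset.sum_nonneg fun j _ => sq_nonneg _
  have hHess := hess_lb (fun j i => DD (e j) (DD (e i) f) z)
  rw [← hS] at hHess
  have hGz : γ * ∑ j, DD (e j) (DD (e j) f) z = - (G z + (γ - 1) * P) := by
    have := heat z
    rw [← hP] at this
    have h2 : G z = P - γ * DD e0 f z := rfl
    rw [h2, this]; ring
  have hnpos : (0:ℝ) < n := by exact_mod_cast hn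
  have hγ1 : 0 < γ - 1 := by linarith
  have hS2 : (G z + (γ - 1) * P) ^ 2 ≤ n * γ ^ 2 * S := by
    have : (G z + (γ - 1) * P) ^ 2 = γ ^ 2 * (∑ j, DD (e j) (DD (e j) f) z) ^ 2 := by
      rw [← mul_pow, hGz]; ring
    rw [this]
    nlinarith [mul_le_mul_of_nonneg_left hHess (sq_nonneg γ)]
  have hmain : 2 * φ z ^ 2 * S ≤
      G z * (2 * φ z * DD e0 φ z - 2 * φ z * L + 6 * Q - 4 * φ z * X) := by
    nlinarith [h0 e0]
  set c : ℝ := 2 / (n * γ ^ 2) with hc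
  have hcpos : 0 < c := by positivity
  have hcS : c * (G z * (G z + 2 * (γ - 1) * P)) ≤ 2 * S := by
    have h3 : G z * (G z + 2 * (γ - 1) * P) ≤ n * γ ^ 2 * S := by
      nlinarith [sq_nonneg ((γ - 1) * P)]
    calc _ ≤ c * (n * γ ^ 2 * S) := by gcongr
      _ = 2 * S := by rw [hc]; field_simp
  have hdiv : c * φ z ^ 2 * (G z + 2 * (γ - 1) * P) ≤
      2 * φ z * DD e0 φ z - 2 * φ z * L + 6 * Q - 4 * φ z * X := by
    refine le_of_mul_le_mul_left ?_ hG
    refine le_trans ?_ hmain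
    nlinarith [mul_le_mul_of_nonneg_left hcS (sq_nonneg (φ z))]
  set k : ℝ := c * (γ - 1) with hk
  have hkpos : 0 < k := by positivity
  have hkk : (n * γ ^ 2 / (γ - 1)) = 2 / k := by rw [hk, hc]; field_simp
  have hyoung : -(4 * φ z * X) ≤ 2 * k * φ z ^ 2 * P + 2 / k * Q := by
    refine le_of_mul_le_mul_right ?_ hkpos
    have e1 : (2 * k * φ z ^ 2 * P + 2 / k * Q) * k = 2 * ((k * φ z) ^ 2 * P + Q) := by
      field_simp
    rw [e1]
    have h7 := young_aux (k * φ z) X P Q hPn hQn hCS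
    linarith
  rw [hkk]
  have e2 : c * φ z ^ 2 * (G z + 2 * (γ - 1) * P)
      = c * (φ z * φ z * G z) + 2 * k * φ z ^ 2 * P := by
    rw [hk]; ring
  linarith
end LY2

section LY3
variable {N : ℕ}
local notation "EE" => EuclideanSpace ℝ (Fin N)

def d0 (N : ℕ) : ℝ × EuclideanSpace ℝ (Fin N) := (1, 0)
noncomputable def di (i : Fin N) : ℝ × EuclideanSpace ℝ (Fin N) := (0, EuclideanSpace.single i 1)

lemma partialT_eq {u : ℝ × EE → ℝ} (hu : Sm u) (t : ℝ) (x : EE) :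
    partialT u t x = DD (d0 N) u (t, x) := by
  have h1 : HasDerivAt (fun s : ℝ => ((s, x) : ℝ × EE)) (1, 0) t :=
    (hasDerivAt_id t).prodMk (hasDerivAt_const t x)
  exact ((hu.da (t, x)).hasFDerivAt.comp_hasDerivAt t h1).deriv

lemma space_fderiv {u : ℝ × EE → ℝ} (hu : Sm u) (t : ℝ) (x : EE) (i : Fin N) :
    fderiv ℝ (fun y => u (t, y)) x (EuclideanSpace.single i 1) = DD (di i) u (t, x) := by
  have h1 : HasFDerivAt (fun y : EE => ((t, y) : ℝ × EE)) (ContinuousLinearMap.inr ℝ ℝ EE) x :=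
    hasFDerivAt_prodMk_right t x
  have h2 := ((hu.da (t, x)).hasFDerivAt.comp x h1).fderiv
  change fderiv ℝ (u ∘ fun y => (t, y)) x _ = _
  rw [h2]; rfl

lemma slap_eq {u : ℝ × EE → ℝ} (hu : Sm u) (t : ℝ) (x : EE) :
    slap u t x = ∑ i, DD (di i) (DD (di i) u) (t, x) := by
  unfold slap lap pd2
  refine Finset.sum_congr rfl fun i _ => ?_
  simp only [space_fderiv hu]
  exact space_fderiv (DD_sm hu (di i)) t x i

lemma sgrad_eq {u : ℝ × EE → ℝ} (hu : Sm u) (t : ℝ) (x : EE) :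
    ‖sgrad u t x‖ ^ 2 = ∑ i, DD (di i) u (t, x) ^ 2 := by
  rw [EuclideanSpace.real_norm_sq_eq]
  refine Finset.sum_congr rfl fun i _ => ?_
  congr 1
  rw [← space_fderiv hu]
  unfold sgrad gradient
  rw [← InnerProductSpace.toDual_symm_apply, EuclideanSpace.inner_single_right]
  simp

noncomputable def ph (δ : ℝ) (z0 z : ℝ × EE) : ℝ :=
  1 - δ ^ 2 * ((z.1 - z0.1) ^ 2 + ∑ i, (z.2 i - z0.2 i) ^ 2)

lemma ph_sm (δ : ℝ) (z0 : ℝ × EE) : Sm (ph δ z0) := by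
  unfold ph Sm; fun_prop

lemma ph_line (δ : ℝ) (z0 z v : ℝ × EE) :
    DD v (ph δ z0) z = - 2 * δ ^ 2 * ((z.1 - z0.1) * v.1 + ∑ i, (z.2 i - z0.2 i) * v.2 i) := by
  have h := line_deriv (ph_sm δ z0) z v 0
  have h2 : HasDerivAt (fun s : ℝ => ph δ z0 (z + s • v))
      (- 2 * δ ^ 2 * ((z.1 - z0.1) * v.1 + ∑ i, (z.2 i - z0.2 i) * v.2 i)) 0 := by
    have ha : ∀ a b c : ℝ, HasDerivAt (fun s : ℝ => (a + s * b - c) ^ 2) (2 * ((a - c) * b)) 0 := by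
      intro a b c
      have := ((((hasDerivAt_id (0:ℝ)).mul_const b).const_add a).sub_const c).pow 2
      refine this.congr_deriv ?_
      simp; ring
    have := (((ha z.1 v.1 z0.1).add (HasDerivAt.fun_sum (u := Finset.univ) fun i _ =>
      ha (z.2 i) (v.2 i) (z0.2 i))).const_mul (δ ^ 2)).const_sub 1
    refine this.congr_deriv ?_
    rw [← Finset.mul_sum]; ring
  simpa using h.unique h2

lemma ph_d0 (δ : ℝ) (z0 z : ℝ × EE) :
    DD (d0 N) (ph δ z0) z = - 2 * δ ^ 2 * (z.1 - z0.1) := by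
  rw [ph_line]; simp [d0]

lemma ph_di (δ : ℝ) (z0 z : ℝ × EE) (i : Fin N) :
    DD (di i) (ph δ z0) z = - 2 * δ ^ 2 * (z.2 i - z0.2 i) := by
  rw [ph_line]; simp [di]

lemma ph_dii (δ : ℝ) (z0 z : ℝ × EE) (i : Fin N) :
    DD (di i) (DD (di i) (ph δ z0)) z = - 2 * δ ^ 2 := by
  have hs := DD_sm (ph_sm δ z0) (di i)
  have h := line_deriv hs z (di i) 0
  have h2 : HasDerivAt (fun s : ℝ => DD (di i) (ph δ z0) (z + s • di i)) (- 2 * δ ^ 2) 0 := by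
    simp only [ph_di]
    have := ((((hasDerivAt_id (0:ℝ)).const_add (z.2 i)).sub_const (z0.2 i)).const_mul
      (- 2 * δ ^ 2))
    have e : (fun s : ℝ => -2 * δ ^ 2 * ((z + s • di i).2 i - z0.2 i))
        = fun y => -2 * δ ^ 2 * (z.2 i + id y - z0.2 i) := by
      funext s; simp [di]
    rw [e]
    exact this.congr_deriv (mul_one _)
  simpa using h.unique h2

set_option maxHeartbeats 1000000 in
lemma local_est (hN : 1 ≤ N) (γ : ℝ) (hγ : 1 < γ) {f : ℝ × EE → ℝ} (hf : Sm f)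
    (heat : ∀ z, DD (d0 N) f z = (∑ j, DD (di j) (DD (di j) f) z)
      + ∑ j, DD (di j) f z * DD (di j) f z)
    (z0 : ℝ × EE) (δ : ℝ) (hδ : 0 < δ) (hδ1 : δ ≤ 1) :
    2 / (N * γ ^ 2) * GG (d0 N) di γ f z0
      ≤ (4 + 4 * N + 4 * (6 + N * γ ^ 2 / (γ - 1))) * δ := by
  have hγ1 : 0 < γ - 1 := by linarith
  have hc : 0 < 2 / (N * γ ^ 2) := by
    have : (0:ℝ) < N := by exact_mod_cast hN
    positivity
  by_cases hG0 : GG (d0 N) di γ f z0 ≤ 0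
  · exact (mul_nonpos_of_nonneg_of_nonpos hc.le hG0).trans (by positivity)
  push Not at hG0
  set K : Set (ℝ × EE) := {z | 0 ≤ ph δ z0 z} with hK
  have hcont : Continuous (ph δ z0) := (ph_sm δ z0).continuous
  have hGc : Continuous (GG (d0 N) di γ f) := (GG_sm (d0 N) di γ hf).continuous
  have hnorm : ∀ z : ℝ × EE, ph δ z0 z = 1 - δ ^ 2 * ((z.1 - z0.1) ^ 2 + ‖z.2 - z0.2‖ ^ 2) := by
    intro z
    rw [EuclideanSpace.real_norm_sq_eq]; simp [ph]
  have hKc : IsCompact K := by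
    apply Metric.isCompact_of_isClosed_isBounded
    · exact isClosed_le continuous_const hcont
    · refine (Metric.isBounded_closedBall (x := z0) (r := 1 / δ)).subset ?_
      intro z hz
      have hz' : 0 ≤ ph δ z0 z := hz
      rw [hnorm] at hz'
      rw [Metric.mem_closedBall, dist_eq_norm, Prod.norm_def, max_le_iff]
      have hδi : (1 / δ) ^ 2 * δ ^ 2 = 1 := by field_simp
      have hδp : 0 ≤ 1 / δ := by positivity
      have hd2 : 0 < δ ^ 2 := by positivity
      constructor
      · apply abs_le_of_sq_le_sq _ hδp
        refine le_of_mul_le_mul_right ?_ hd2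
        rw [hδi]
        have : 0 ≤ δ ^ 2 * ‖z.2 - z0.2‖ ^ 2 := by positivity
        have e : (z - z0).1 = z.1 - z0.1 := rfl
        rw [e]; nlinarith
      · refine (sq_le_sq₀ (norm_nonneg _) hδp).1 ?_
        refine le_of_mul_le_mul_right ?_ hd2
        rw [hδi]
        have : 0 ≤ δ ^ 2 * (z.1 - z0.1) ^ 2 := by positivity
        have e : (z - z0).2 = z.2 - z0.2 := rfl
        rw [e]; nlinarith
  have hph0 : ph δ z0 z0 = 1 := by simp [ph]
  have hz0K : z0 ∈ K := by rw [hK, Set.mem_ofPred_eq, hph0]; norm_num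
  obtain ⟨z, hzK, hzmax⟩ := hKc.exists_isMaxOn ⟨z0, hz0K⟩
    (f := fun z => ph δ z0 z * ph δ z0 z * GG (d0 N) di γ f z) (by fun_prop)
  have hM := hzmax hz0K
  simp only [Set.mem_ofPred_eq, hph0, one_mul] at hM
  have hzK' : 0 ≤ ph δ z0 z := hzK
  have hφ : 0 < ph δ z0 z := by
    rcases hzK'.lt_or_eq with h | h
    · exact h
    · rw [← h] at hM; linarith
  have hGz : 0 < GG (d0 N) di γ f z := by
    have : 0 < ph δ z0 z * ph δ z0 z * GG (d0 N) di γ f z := by linarith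
    exact (pos_iff_pos_of_mul_pos this).1 (by positivity)
  have hloc : IsLocalMax (fun z => ph δ z0 z * ph δ z0 z * GG (d0 N) di γ f z) z := by
    refine hzmax.isLocalMax ?_
    exact Filter.mem_of_superset ((isOpen_lt continuous_const hcont).mem_nhds hφ)
      (fun y hy => show 0 ≤ ph δ z0 y from le_of_lt hy)
  have key := key_max hN (d0 N) di γ hγ hf heat (ph_sm δ z0) z hφ hGz hloc
  refine (mul_le_mul_of_nonneg_left hM hc.le).trans (key.trans ?_)
  simp only [ph_d0, ph_di, ph_dii, Finset.sum_const, Finset.card_univ, Fintype.card_fin,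
    nsmul_eq_mul]
  have hQ : ∑ j, (-2 * δ ^ 2 * (z.2 j - z0.2 j)) ^ 2
      = 4 * δ ^ 2 * (δ ^ 2 * ∑ j, (z.2 j - z0.2 j) ^ 2) := by
    rw [Finset.mul_sum, Finset.mul_sum]
    exact Finset.sum_congr rfl fun j _ => by ring
  rw [hQ]
  have hphz : ph δ z0 z = 1 - δ ^ 2 * ((z.1 - z0.1) ^ 2 + ∑ i, (z.2 i - z0.2 i) ^ 2) := rfl
  set S := ∑ j, (z.2 j - z0.2 j) ^ 2
  have hS : 0 ≤ S := Finset.sum_nonneg fun j _ => sq_nonneg _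
  set τ := z.1 - z0.1
  set p := ph δ z0 z
  have hS1 : 0 ≤ δ ^ 2 * S := by positivity
  have hτ1 : 0 ≤ δ ^ 2 * τ ^ 2 := by positivity
  have hp1 : p ≤ 1 := by nlinarith
  have hS2 : δ ^ 2 * S ≤ 1 := by nlinarith
  have hτ2 : (δ * τ) ^ 2 ≤ 1 ^ 2 := by nlinarith
  have hτ3 := abs_le_of_sq_le_sq' hτ2 zero_le_one
  have hδ2 : δ ^ 2 ≤ δ := by nlinarith
  have hCpos : 0 ≤ 6 + N * γ ^ 2 / (γ - 1) := by positivity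
  set C := 6 + N * γ ^ 2 / (γ - 1)
  have t1 : 2 * p * (-2 * δ ^ 2 * τ) ≤ 4 * δ := by
    have : 2 * p * (-2 * δ ^ 2 * τ) = 4 * δ * (p * (-(δ * τ))) := by ring
    rw [this]
    have : p * (-(δ * τ)) ≤ 1 := by nlinarith
    nlinarith
  have t2 : -(2 * p * (N * (-2 * δ ^ 2))) ≤ 4 * N * δ := by
    have : -(2 * p * (N * (-2 * δ ^ 2))) = 4 * N * (p * δ ^ 2) := by ring
    rw [this]
    have : p * δ ^ 2 ≤ δ := by nlinarith
    gcongr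
  have t3 : C * (4 * δ ^ 2 * (δ ^ 2 * S)) ≤ 4 * C * δ := by
    have : C * (4 * δ ^ 2 * (δ ^ 2 * S)) = 4 * C * (δ ^ 2 * (δ ^ 2 * S)) := by ring
    rw [this]
    have : δ ^ 2 * (δ ^ 2 * S) ≤ δ := by nlinarith [sq_nonneg δ]
    gcongr
  linarith

lemma GG_nonpos (hN : 1 ≤ N) (γ : ℝ) (hγ : 1 < γ) {f : ℝ × EE → ℝ} (hf : Sm f)
    (heat : ∀ z, DD (d0 N) f z = (∑ j, DD (di j) (DD (di j) f) z)
      + ∑ j, DD (di j) f z * DD (di j) f z)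
    (z0 : ℝ × EE) : GG (d0 N) di γ f z0 ≤ 0 := by
  have hγ1 : 0 < γ - 1 := by linarith
  have hc : 0 < 2 / (N * γ ^ 2) := by
    have : (0:ℝ) < N := by exact_mod_cast hN
    positivity
  have hKp : 0 < 4 + 4 * N + 4 * (6 + N * γ ^ 2 / (γ - 1)) := by positivity
  have est := local_est hN γ hγ hf heat z0
  set K := 4 + 4 * N + 4 * (6 + N * γ ^ 2 / (γ - 1))
  by_contra h
  push Not at h
  set a := 2 / (N * γ ^ 2) * GG (d0 N) di γ f z0
  have ha : 0 < a := mul_pos hc h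
  have h1 := est (min 1 (a / (2 * K))) (by positivity) (min_le_left _ _)
  have h2 : K * min 1 (a / (2 * K)) ≤ K * (a / (2 * K)) := by
    gcongr; exact min_le_right _ _
  have h3 : K * (a / (2 * K)) = a / 2 := by field_simp
  linarith
end LY3

theorem li_yau_heat_euclidean {N : ℕ} (hN : 1 ≤ N)
    (u : ℝ × EuclideanSpace ℝ (Fin N) → ℝ) (hu : ContDiff ℝ (⊤ : ℕ∞) u)
    (hpos : ∀ z, 0 < u z)
    (heq : ∀ t x, partialT u t x = slap u t x)
    (γ : ℝ) (hγ : 1 < γ) (t : ℝ) (x : EuclideanSpace ℝ (Fin N)) :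
    (‖sgrad u t x‖ / u (t, x)) ^ 2
      - γ * partialT (fun z => Real.log (u z)) t x ≤ 0 := by
  set f : ℝ × EuclideanSpace ℝ (Fin N) → ℝ := fun z => Real.log (u z) with hfdef
  have hf : Sm f := hu.log (fun z => (hpos z).ne')
  have hDu : ∀ v z, DD v u z = u z * DD v f z := by
    intro v z
    have h := ((Sm.da hu z).hasFDerivAt.log (hpos z).ne').fderiv
    unfold DD
    rw [h]
    have := (hpos z).ne'
    simp [this]
  have hDDu : ∀ v z, DD v (DD v u) z = u z * (DD v (DD v f) z + DD v f z * DD v f z) := by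
    intro v z
    rw [show DD v u = fun z => u z * DD v f z from funext (hDu v), DD_mul hu (DD_sm hf v), hDu]
    ring
  have heat : ∀ z, DD (d0 N) f z = (∑ j, DD (di j) (DD (di j) f) z)
      + ∑ j, DD (di j) f z * DD (di j) f z := by
    rintro ⟨s, y⟩
    have h := heq s y
    rw [partialT_eq hu, slap_eq hu, hDu] at h
    simp only [hDDu] at h
    rw [← Finset.mul_sum, Finset.sum_add_distrib] at h
    exact mul_left_cancel₀ (hpos _).ne' h
  have h := GG_nonpos hN γ hγ hf heat (t, x)
  rw [partialT_eq hf, div_pow, sgrad_eq hu]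
  have e : (∑ i, DD (di i) u (t, x) ^ 2) / u (t, x) ^ 2
      = ∑ i, DD (di i) f (t, x) * DD (di i) f (t, x) := by
    rw [Finset.sum_div]
    refine Finset.sum_congr rfl fun i _ => ?_
    rw [hDu]
    have := (hpos (t, x)).ne'
    field_simp
  rw [e]
  exact h
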